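/- Let R be a d-dimensional (d ≥ 2) Cohen-Macaulay equi-codimensional normal domain with canonical module, let End_R(M) be a noncommutative crepant resolution of R, and set Λ = End_R(M). Then for any finitely generated reflexive R-module N, the Λ-module Hom_R(M, N) has projective dimension at most d - 2. -/

import Mathlib

open CategoryTheory IsLocalRing
open scoped Classical

universe u

noncomputable section

/-- The depth of a module over a Noetherian local ring: the supremum of lengths of
regular sequences contained in the maximal ideal (with `depth 0 = ⊤`). -/
def rdepth (R : Type u) [CommRing R] [IsLocalRing R]
    (M : Type u) [AddCommGroup M] [Module R M] : ℕ∞ :=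
  if Subsingleton M then ⊤
  else sSup {n : ℕ∞ | ∃ rs : List R, (∀ r ∈ rs, r ∈ IsLocalRing.maximalIdeal R) ∧
    RingTheory.Sequence.IsRegular M rs ∧ (rs.length : ℕ∞) = n}

/-- Vanishing of `Ext^i` over an arbitrary ring. -/
def extVanish (A : Type u) [Ring A] (i : ℕ) (X Y : ModuleCat.{u} A) : Prop :=
  Subsingleton (((Ext ℤ (ModuleCat.{u} A) i).obj (Opposite.op X)).obj Y)

/-- Projective dimension, via vanishing of Ext. -/
def projDim (A : Type u) [Ring A] (X : Type u) [AddCommGroup X] [Module A X] : ℕ∞ :=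
  sInf {n : ℕ∞ | ∀ i : ℕ, n < (i : ℕ∞) → ∀ Y : ModuleCat.{u} A,
    extVanish A i (ModuleCat.of A X) Y}

/-- Global dimension of a ring, via vanishing of Ext. -/
def globalDim (A : Type u) [Ring A] : ℕ∞ :=
  sInf {n : ℕ∞ | ∀ i : ℕ, n < (i : ℕ∞) → ∀ X Y : ModuleCat.{u} A, extVanish A i X Y}

/-- A Noetherian local ring is Cohen-Macaulay if its depth equals its Krull dimension. -/
def IsCMLocalRing (R : Type u) [CommRing R] [IsLocalRing R] : Prop :=
  (rdepth R R : WithBot ℕ∞) = ringKrullDim R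

/-- A ring is Cohen-Macaulay if all its localizations at primes are Cohen-Macaulay. -/
def IsCMRing (R : Type u) [CommRing R] : Prop :=
  ∀ (p : Ideal R) (hp : p.IsPrime),
    letI := hp
    IsCMLocalRing (Localization.AtPrime p)

/-- A canonical module of a local ring: a maximal Cohen-Macaulay module of finite injective
dimension whose endomorphism ring is `R`. -/
structure IsCanonicalModule (R : Type u) [CommRing R] [IsLocalRing R]
    (w : Type u) [AddCommGroup w] [Module R w] : Prop where
  finite : Module.Finite R w
  mcm : (rdepth R w : WithBot ℕ∞) = ringKrullDim R
  finInjDim : ∃ n : ℕ, ∀ i : ℕ, n < i → ∀ X : ModuleCat.{u} R,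
    extVanish R i X (ModuleCat.of R w)
  endIso : Nonempty (Module.End R w ≃+* R)

/-- A canonical module of a (not necessarily local) ring: a finitely generated module
which localizes to a canonical module at every maximal ideal. -/
def IsGlobalCanonicalModule (R : Type u) [CommRing R]
    (w : Type u) [AddCommGroup w] [Module R w] : Prop :=
  Module.Finite R w ∧
  ∀ (m : Ideal R) (hm : m.IsMaximal),
    letI := hm.isPrime
    IsCanonicalModule (Localization.AtPrime m) (LocalizedModule m.primeCompl w)

/-- The height of a prime ideal. -/
def primeHeight {R : Type u} [CommRing R] (p : Ideal R) (hp : p.IsPrime) : ℕ∞ :=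
  Order.height (⟨p, hp⟩ : PrimeSpectrum R)

/-- All maximal ideals have the same height. -/
def EquiCodimensional (R : Type u) [CommRing R] : Prop :=
  ∀ (m₁ m₂ : Ideal R) (h₁ : m₁.IsMaximal) (h₂ : m₂.IsMaximal),
    primeHeight m₁ h₁.isPrime = primeHeight m₂ h₂.isPrime

/-- A non-singular `R`-order: a module-finite `R`-algebra which is a maximal Cohen-Macaulay
`R`-module and such that `gl.dim Λ_p = dim R_p` for all primes `p` of `R`. -/
structure IsNonsingularOrder (R : Type u) [CommRing R]
    (L : Type u) [Ring L] [Algebra R L] : Prop where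
  finite : Module.Finite R L
  mcm : ∀ (p : Ideal R) (hp : p.IsPrime),
    letI := hp
    (rdepth (Localization.AtPrime p) (LocalizedModule p.primeCompl L) : WithBot ℕ∞)
      = ringKrullDim (Localization.AtPrime p)
  gldim : ∀ (p : Ideal R) (hp : p.IsPrime),
    letI := hp
    (globalDim (LocalizedModule p.primeCompl L) : WithBot ℕ∞)
      = ringKrullDim (Localization.AtPrime p)

/-- `Hom_R(M,N)` is a left module over `End_R(M)^op` via precomposition.
(The paper's convention `fg = f then g` makes its `End_R(M)` the opposite of Mathlib's.) -/
instance endOpModuleHom {R M N : Type u} [CommRing R] [AddCommGroup M] [Module R M]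
    [AddCommGroup N] [Module R N] :
    Module (Module.End R M)ᵐᵒᵖ (M →ₗ[R] N) where
  smul a g := g ∘ₗ a.unop
  one_smul g := LinearMap.ext fun _ => rfl
  mul_smul a b g := LinearMap.ext fun _ => rfl
  smul_zero a := LinearMap.ext fun _ => rfl
  smul_add a g h := LinearMap.ext fun _ => rfl
  add_smul a b g := LinearMap.ext fun x => g.map_add _ _
  zero_smul g := LinearMap.ext fun x => g.map_zero

/-- A noncommutative crepant resolution: `End_R(M)` for a nonzero finitely generated
reflexive `R`-module `M` such that `End_R(M)` is a non-singular `R`-order. -/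
def IsNCCR (R : Type u) [CommRing R] (M : Type u) [AddCommGroup M] [Module R M] : Prop :=
  Nontrivial M ∧ Module.Finite R M ∧ Module.IsReflexive R M ∧
    IsNonsingularOrder R (Module.End R M)ᵐᵒᵖ

/-- `X ∈ add M`: `X` is a direct summand of a finite direct sum of copies of `M`. -/
def InAdd (A : Type u) [Ring A] (M : Type u) [AddCommGroup M] [Module A M]
    (X : Type u) [AddCommGroup X] [Module A X] : Prop :=
  ∃ (n : ℕ) (s : X →ₗ[A] (Fin n → M)) (r : (Fin n → M) →ₗ[A] X),
    r ∘ₗ s = LinearMap.id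

end

section ExtVanish

open Limits

variable {A : Type u} [Ring A]

lemma extVanish_succ_iff {X Y : ModuleCat.{u} A} (P : ProjectiveResolution X) (n : ℕ) :
    extVanish A (n + 1) X Y ↔ ∀ f : P.complex.X (n + 1) ⟶ Y, P.complex.d (n + 2) (n + 1) ≫ f = 0 →
      ∃ g : P.complex.X n ⟶ Y, P.complex.d (n + 1) n ≫ g = f := by
  have h1 : extVanish A (n + 1) X Y ↔
      (P.complex.linearYonedaObj ℤ Y).ExactAt (n + 1) := by
    rw [HomologicalComplex.exactAt_iff_isZero_homology, ← (P.isoExt (R := ℤ) (n + 1) Y).isZero_iff,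
      ModuleCat.isZero_iff_subsingleton]
    rfl
  rw [h1, HomologicalComplex.exactAt_iff' _ n (n + 1) (n + 2) (by simp) (by simp),
    ShortComplex.moduleCat_exact_iff]
  rfl

lemma ext_succ_subsingleton_iff {X Y : ModuleCat.{u} A} (P : ProjectiveResolution X) (n : ℕ) :
    Subsingleton (Abelian.Ext X Y (n + 1)) ↔
      ∀ f : P.complex.X (n + 1) ⟶ Y, P.complex.d (n + 2) (n + 1) ≫ f = 0 →
        ∃ g : P.complex.X n ⟶ Y, P.complex.d (n + 1) n ≫ g = f := by
  constructor
  · intro h f hf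
    exact (P.extMk_eq_zero_iff f (n + 2) rfl hf n rfl).1 (Subsingleton.elim _ _)
  · refine fun h ↦ subsingleton_of_forall_eq 0 fun α ↦ ?_
    obtain ⟨f, hf, rfl⟩ := P.extMk_surjective α (n + 2) rfl
    exact (P.extMk_eq_zero_iff f (n + 2) rfl hf n rfl).2 (h f hf)

lemma extVanish_succ_iff_subsingleton_ext (X Y : ModuleCat.{u} A) (n : ℕ) :
    extVanish A (n + 1) X Y ↔ Subsingleton (Abelian.Ext X Y (n + 1)) := by
  let P := projectiveResolution X
  rw [extVanish_succ_iff P, ext_succ_subsingleton_iff P]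

lemma forall_extVanish_iff_hasProjectiveDimensionLT (X : ModuleCat.{u} A) (n : ℕ) :
    (∀ i : ℕ, (n : ℕ∞) < i → ∀ Y : ModuleCat.{u} A, extVanish A i X Y) ↔
      HasProjectiveDimensionLT X (n + 1) := by
  constructor
  · refine fun h ↦ (hasProjectiveDimensionLT_iff X (n + 1)).2 fun i hi Y e ↦ ?_
    obtain ⟨j, rfl⟩ : ∃ j, i = j + 1 := ⟨i - 1, by lia⟩
    have := (extVanish_succ_iff_subsingleton_ext X Y j).1 (h (j + 1) (by exact_mod_cast hi) Y)
    exact Subsingleton.elim _ _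
  · intro h i hi Y
    have hi' : n < i := by exact_mod_cast hi
    obtain ⟨j, rfl⟩ : ∃ j, i = j + 1 := ⟨i - 1, by lia⟩
    rw [extVanish_succ_iff_subsingleton_ext]
    exact HasProjectiveDimensionLT.subsingleton X (n + 1) _ hi' Y

lemma projDim_le_of_hasProjectiveDimensionLT (X : Type u) [AddCommGroup X] [Module A X] (n : ℕ)
    (h : HasProjectiveDimensionLT (ModuleCat.of A X) (n + 1)) : projDim A X ≤ n :=
  sInf_le ((forall_extVanish_iff_hasProjectiveDimensionLT _ n).2 h)

lemma hasProjectiveDimensionLT_of_globalDim_le {n : ℕ} (h : globalDim A ≤ n)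
    (X : ModuleCat.{u} A) : HasProjectiveDimensionLT X (n + 1) := by
  have hmem : globalDim A ∈ {n : ℕ∞ | ∀ i : ℕ, n < (i : ℕ∞) →
      ∀ X Y : ModuleCat.{u} A, extVanish A i X Y} :=
    csInf_mem ⟨⊤, fun i hi ↦ absurd hi (by simp)⟩
  exact (forall_extVanish_iff_hasProjectiveDimensionLT X n).1
    fun i hi Y ↦ hmem i (h.trans_lt hi) X Y

end ExtVanish

section Nakayama

open Abelian

namespace ModuleCat

variable {A : Type u} [Ring A]

lemma hasProjectiveDimensionLT_of_forall_finite_ext [IsNoetherianRing A] (X : ModuleCat.{u} A)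
    [Module.Finite A X] (n : ℕ)
    (h : ∀ L : ModuleCat.{u} A, Module.Finite A L → Subsingleton (Ext X L (n + 1))) :
    HasProjectiveDimensionLT X (n + 1) := by
  induction n generalizing X with
  | zero =>
    obtain ⟨k, f, surjf⟩ := Module.Finite.exists_fin' A X
    let T : ShortComplex (ModuleCat.{u} A) := f.shortComplexKer
    have hT : T.ShortExact := LinearMap.shortExact_shortComplexKer surjf
    rw [zero_add, ← projective_iff_hasProjectiveDimensionLT_one]
    have : Subsingleton (Ext X T.X₁ 1) := h T.X₁ inferInstance
    rcases Ext.covariant_sequence_exact₃ X hT (Ext.mk₀ (𝟙 X)) (zero_add 1)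
      (Subsingleton.eq_zero _) with ⟨f', hf'⟩
    rcases (Ext.mk₀_bijective X T.X₂).2 f' with ⟨f, hf⟩
    rw [← hf, Ext.mk₀_comp_mk₀, (Ext.mk₀_bijective _ _).1.eq_iff] at hf'
    exact (Retract.mk f T.g hf').projective
  | succ n hn =>
    obtain ⟨k, f, surjf⟩ := Module.Finite.exists_fin' A X
    let T : ShortComplex (ModuleCat.{u} A) := f.shortComplexKer
    have hT : T.ShortExact := LinearMap.shortExact_shortComplexKer surjf
    rw [hT.hasProjectiveDimensionLT_X₃_iff n inferInstance]
    refine hn T.X₁ fun L hL ↦ ?_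
    have := h L hL
    refine subsingleton_of_forall_eq 0 fun α ↦ ?_
    obtain ⟨β, rfl⟩ := Ext.contravariant_sequence_exact₁ hT L α (add_comm 1 (n + 1))
      (Subsingleton.elim _ _)
    have := Ext.subsingleton_of_projective T.X₂ L n
    rw [Subsingleton.elim β 0, Ext.comp_zero]

variable (S : Type u) [CommRing S] [Algebra S A]

/-- A module over an `S`-algebra is a module over `S`. -/
@[reducible]
def moduleOfAlgebra (M : ModuleCat.{u} A) : Module S M :=
  Module.restrictScalars S A M

attribute [local instance] moduleOfAlgebra

lemma isScalarTower_moduleOfAlgebra (M : ModuleCat.{u} A) : IsScalarTower S A M :=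
  IsScalarTower.restrictScalars S A M

attribute [local instance] isScalarTower_moduleOfAlgebra

/-- Modules over an `S`-algebra form an `S`-linear category. -/
@[reducible]
def linearOfAlgebra : Linear S (ModuleCat.{u} A) where
  homModule _ _ := inferInstance

attribute [local instance] linearOfAlgebra

variable [IsNoetherianRing S] [Module.Finite S A]

lemma finite_ext_of_algebra [IsNoetherianRing A] (X Y : ModuleCat.{u} A) [Module.Finite A X]
    [Module.Finite A Y] (i : ℕ) : Module.Finite S (Ext X Y i) := by
  induction i generalizing X with
  | zero =>
    have : Module.Finite S X := Module.Finite.trans A X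
    have : Module.Finite S Y := Module.Finite.trans A Y
    have h1 : Module.Finite S (X →ₗ[A] Y) := by
      let φ : (X →ₗ[A] Y) →ₗ[S] (X →ₗ[S] Y) :=
        { toFun f := f.restrictScalars S
          map_add' _ _ := rfl
          map_smul' _ _ := rfl }
      exact Module.Finite.of_injective φ (LinearMap.restrictScalars_injective S)
    exact Module.Finite.equiv (Ext.linearEquiv₀.trans (ModuleCat.homLinearEquiv (S := S))).symm
  | succ n ih =>
    obtain ⟨k, f, surjf⟩ := Module.Finite.exists_fin' A X
    let exac := LinearMap.shortExact_shortComplexKer surjf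
    have := ih (f.shortComplexKer.X₁)
    exact Module.Finite.of_surjective (exac.extClass.precompOfLinear S Y (add_comm 1 n))
      (precomp_extClass_surjective_of_projective_X₂ Y exac n)

variable [IsLocalRing S] {S}

lemma hasProjectiveDimensionLT_of_quotient (X Z : ModuleCat.{u} A) [Module.Finite A X]
    {x : S} (hx : x ∈ maximalIdeal S) (f : X ⟶ X) (hf : ∀ a : X, f a = algebraMap S A x • a)
    (g : X ⟶ Z) (w : f ≫ g = 0) (hT : (ShortComplex.mk _ g w).ShortExact) (n : ℕ)
    [HasProjectiveDimensionLT Z (n + 2)] :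
    HasProjectiveDimensionLT X (n + 1) := by
  have hfx : f = x • 𝟙 X := by
    ext a
    rw [hf, ModuleCat.hom_smul, LinearMap.smul_apply, algebraMap_smul]
    rfl
  have : IsNoetherian S A := isNoetherian_of_isNoetherianRing_of_finite S A
  have : IsNoetherianRing A := isNoetherian_of_tower S this
  refine hasProjectiveDimensionLT_of_forall_finite_ext X n fun L hL ↦ ?_
  have hfin := finite_ext_of_algebra S X L (n + 1)
  have hZ := HasProjectiveDimensionLT.subsingleton Z (n + 2) _ le_rfl L
  have htop : (⊤ : Submodule S (Ext X L (n + 1))) ≤ maximalIdeal S • ⊤ := by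
    intro α _
    obtain ⟨β, hβ⟩ := Ext.contravariant_sequence_exact₁ hT L α (add_comm 1 (n + 1))
      (hZ.elim _ _)
    have : α = x • β := by
      simpa [hfx, Ext.mk₀_smul, Ext.smul_comp, Ext.mk₀_id_comp] using hβ.symm
    rw [this]
    exact Submodule.smul_mem_smul hx trivial
  have hbot := Submodule.eq_bot_of_le_smul_of_le_jacobson_bot (maximalIdeal S) ⊤ hfin.1 htop
    (IsLocalRing.maximalIdeal_le_jacobson _)
  exact subsingleton_of_forall_eq 0 fun α ↦ by
    simpa using hbot.le (Submodule.mem_top (x := α))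

end ModuleCat

variable {A : Type u} [Ring A] {S : Type u} [CommRing S] [IsLocalRing S] [IsNoetherianRing S]
  [Algebra S A] [Module.Finite S A]
  (X : Type u) [AddCommGroup X] [Module A X] [Module.Finite A X] [Module S X] [IsScalarTower S A X]

lemma hasProjectiveDimensionLT_of_isSMulRegular {x : S} (hx : x ∈ maximalIdeal S)
    (hreg : IsSMulRegular X x) (n : ℕ)
    (h : HasProjectiveDimensionLT
      (ModuleCat.of A (X ⧸ LinearMap.range (x • (LinearMap.id : X →ₗ[A] X)))) (n + 2)) :
    HasProjectiveDimensionLT (ModuleCat.of A X) (n + 1) := by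
  let f : X →ₗ[A] X := x • LinearMap.id
  have hfg : f.range.mkQ ∘ₗ f = 0 := LinearMap.range_mkQ_comp f
  refine ModuleCat.hasProjectiveDimensionLT_of_quotient (ModuleCat.of A X)
    (ModuleCat.of A (X ⧸ LinearMap.range f)) hx (ModuleCat.ofHom f)
    (fun a ↦ (algebraMap_smul A x a).symm) (ModuleCat.ofHom f.range.mkQ)
    (ModuleCat.hom_ext hfg) ?_ n
  refine { exact := ?_, mono_f := ?_, epi_g := ?_ }
  · exact (ShortComplex.ShortExact.moduleCat_exact_iff_function_exact _).2
      (LinearMap.exact_map_mkQ_range f)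
  · exact (ModuleCat.mono_iff_injective _).2 hreg
  · exact (ModuleCat.epi_iff_surjective _).2 (Submodule.mkQ_surjective _)

lemma hasProjectiveDimensionLT_of_regular_pair {x y : S} (hx : x ∈ maximalIdeal S)
    (hy : y ∈ maximalIdeal S) (hxreg : IsSMulRegular X x)
    (hyreg : ∀ a b : X, y • a = x • b → ∃ c : X, a = x • c) (n : ℕ)
    (hA : ∀ Z : ModuleCat.{u} A, HasProjectiveDimensionLT Z (n + 3)) :
    HasProjectiveDimensionLT (ModuleCat.of A X) (n + 1) := by
  refine hasProjectiveDimensionLT_of_isSMulRegular X hx hxreg n ?_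
  refine hasProjectiveDimensionLT_of_isSMulRegular _ hy ?_ (n + 1) (hA _)
  refine isSMulRegular_iff_right_eq_zero_of_smul.2 fun a ha ↦ ?_
  induction a using Submodule.Quotient.induction_on with | _ a
  obtain ⟨b, hb⟩ := (Submodule.Quotient.mk_eq_zero _).1
    ((Submodule.Quotient.mk_smul _ y a).trans ha)
  obtain ⟨c, rfl⟩ := hyreg a b hb.symm
  exact (Submodule.Quotient.mk_eq_zero _).2 ⟨c, rfl⟩

end Nakayama

section RegularPair

open RingTheory.Sequence

lemma exists_regular_pair_of_two_le_rdepth {S : Type u} [CommRing S] [IsLocalRing S]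
    (h : 2 ≤ rdepth S S) :
    ∃ x ∈ maximalIdeal S, ∃ y ∈ maximalIdeal S, IsSMulRegular S x ∧
      ∀ a b : S, y * a = x * b → ∃ c, a = x * c := by
  rw [rdepth, if_neg (not_subsingleton S)] at h
  obtain ⟨_, ⟨rs, hrs, hreg, rfl⟩, hlt⟩ := lt_sSup_iff.1
    (lt_of_lt_of_le (Nat.cast_lt.2 one_lt_two) h)
  match rs, hrs, hreg, hlt with
  | x :: y :: l, hrs, hreg, _ =>
    have h1 := (isWeaklyRegular_cons_iff S x _).1 hreg.toIsWeaklyRegular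
    have h2 := ((isWeaklyRegular_cons_iff _ y _).1 h1.2).1
    refine ⟨x, hrs x (by simp), y, hrs y (by simp), h1.1, fun a b hab ↦ ?_⟩
    have ha : y • (Submodule.Quotient.mk a : QuotSMulTop x S) = 0 := by
      rw [← Submodule.Quotient.mk_smul, Submodule.Quotient.mk_eq_zero]
      exact (Submodule.mem_smul_pointwise_iff_exists _ _ _).2 ⟨b, trivial, hab.symm⟩
    have ha' := isSMulRegular_iff_right_eq_zero_of_smul.1 h2 _ ha
    rw [Submodule.Quotient.mk_eq_zero, Submodule.mem_smul_pointwise_iff_exists] at ha'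
    obtain ⟨c, -, hc⟩ := ha'
    exact ⟨c, hc.symm⟩
  | [x], _, _, h => simp at h
  | [], _, _, h => simp at h

variable {R S : Type u} [CommRing R] [CommRing S] [Algebra R S] {x y : S}
  (W : Type u) [AddCommGroup W] [Module R W]

lemma IsSMulRegular.linearMap (hx : IsSMulRegular S x) : IsSMulRegular (W →ₗ[R] S) x := fun _ _ h ↦
  LinearMap.ext fun w ↦ hx (LinearMap.congr_fun h w)

lemma exists_eq_smul_linearMap_of_regular_pair (hx : IsSMulRegular S x)
    (hxy : ∀ a b : S, y * a = x * b → ∃ c, a = x * c) (f g : W →ₗ[R] S)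
    (hfg : y • f = x • g) : ∃ c, f = x • c := by
  choose c hc using fun w ↦ hxy (f w) (g w) (LinearMap.congr_fun hfg w)
  refine ⟨{ toFun := c, map_add' v w := hx ?_, map_smul' r w := hx ?_ }, LinearMap.ext hc⟩
  · change x * c (v + w) = x * (c v + c w)
    rw [mul_add, ← hc, ← hc, ← hc, map_add]
  · change x * c (r • w) = x * (r • c w)
    rw [mul_smul_comm, ← hc, ← hc, map_smul]

end RegularPair

section Localization

variable {R : Type u} [CommRing R] (T : Submonoid R) (L : Type u) [Ring L] [Algebra R L]

/-- The localization of an `R`-algebra is an algebra over the localization of `R`. -/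
@[reducible]
noncomputable def localizedAlgebra : Algebra (Localization T) (LocalizedModule T L) :=
  Algebra.ofModule
    (fun r x y ↦ by
      induction r using Localization.induction_on with | _ r
      induction x, y using LocalizedModule.induction_on₂ with | _ a s b t
      simp only [LocalizedModule.mk_smul_mk, LocalizedModule.mk_mul_mk, smul_mul_assoc, mul_assoc])
    (fun r x y ↦ by
      induction r using Localization.induction_on with | _ r
      induction x, y using LocalizedModule.induction_on₂ with | _ a s b t
      simp only [LocalizedModule.mk_smul_mk, LocalizedModule.mk_mul_mk, mul_smul_comm,
        mul_left_comm])

variable (X : Type u) [AddCommGroup X] [Module R X] [Module L X] [IsScalarTower R L X]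

/-- The action of the localization of an `R`-algebra on the localization of a module. -/
noncomputable def localizedAction : LocalizedModule T L →ₗ[R] Module.End R (LocalizedModule T X) :=
  IsLocalizedModule.lift T (LocalizedModule.mkLinearMap T L)
    (IsLocalizedModule.map T (LocalizedModule.mkLinearMap T X) (LocalizedModule.mkLinearMap T X) ∘ₗ
      (Algebra.lsmul R R X : L →ₐ[R] Module.End R X).toLinearMap)
    fun s ↦ (Module.End.isUnit_iff _).2 <| by
      have h := (Module.End.isUnit_iff _).1
        (IsLocalizedModule.map_units (LocalizedModule.mkLinearMap T X) s)
      refine ⟨fun f g hfg ↦ LinearMap.ext fun x ↦ h.1 (LinearMap.congr_fun hfg x), fun f ↦ ?_⟩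
      refine ⟨(LinearEquiv.ofBijective _ h).symm.toLinearMap ∘ₗ f, LinearMap.ext fun x ↦ ?_⟩
      exact (LinearEquiv.ofBijective _ h).apply_symm_apply (f x)

lemma localizedAction_mk_mk (a : L) (s t : T) (x : X) :
    localizedAction T L X (LocalizedModule.mk a s) (LocalizedModule.mk x t) =
      LocalizedModule.mk (a • x) (s * t) := by
  have h : s • localizedAction T L X (LocalizedModule.mk a s) (LocalizedModule.mk x t) =
      localizedAction T L X (LocalizedModule.mk a 1) (LocalizedModule.mk x t) := by
    have hs : LocalizedModule.mk a 1 = (s : R) • LocalizedModule.mk a s :=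
      (LocalizedModule.mk_cancel s a).symm.trans (LocalizedModule.smul'_mk (s : R) a s).symm
    rw [hs, map_smul, LinearMap.smul_apply, Submonoid.smul_def]
  refine IsLocalizedModule.smul_injective (LocalizedModule.mkLinearMap T X) s (h.trans ?_)
  have h1 : localizedAction T L X (LocalizedModule.mk a 1) =
      IsLocalizedModule.map T (LocalizedModule.mkLinearMap T X) (LocalizedModule.mkLinearMap T X)
        (Algebra.lsmul R R X a) :=
    IsLocalizedModule.lift_apply T (LocalizedModule.mkLinearMap T L) _ _ a
  rw [h1, IsLocalizedModule.map_LocalizedModules]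
  exact ((LocalizedModule.smul'_mk (s : R) (a • x) (s * t)).trans
    (LocalizedModule.mk_cancel_common_left s t (a • x))).symm

/-- The localization of a module over an `R`-algebra is a module over the localized algebra. -/
@[reducible]
noncomputable def localizedAlgebraModule : Module (LocalizedModule T L) (LocalizedModule T X) where
  smul a x := localizedAction T L X a x
  one_smul x := by
    induction x using LocalizedModule.induction_on with | _ x s
    change localizedAction T L X 1 _ = _
    rw [OreLocalization.one_def]
    exact (localizedAction_mk_mk T L X 1 1 s x).trans (by rw [one_smul, one_mul])
  mul_smul a b x := by
    induction x using LocalizedModule.induction_on with | _ x s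
    induction a, b using LocalizedModule.induction_on₂ with | _ a t b u
    change localizedAction T L X _ _ = localizedAction T L X _ (localizedAction T L X _ _)
    simp only [LocalizedModule.mk_mul_mk, localizedAction_mk_mk, mul_smul, mul_assoc]
  smul_zero a := map_zero _
  smul_add a := map_add _
  add_smul a b x := by
    change localizedAction T L X _ _ = localizedAction T L X _ _ + localizedAction T L X _ _
    rw [map_add, LinearMap.add_apply]
  zero_smul x := by
    change localizedAction T L X _ _ = 0
    rw [map_zero, LinearMap.zero_apply]

attribute [local instance] localizedAlgebra localizedAlgebraModule

variable {L X}

lemma LocalizedModule.mk_smul_mk_of_algebra (a : L) (s t : T) (x : X) :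
    LocalizedModule.mk a s • LocalizedModule.mk x t = LocalizedModule.mk (a • x) (s * t) :=
  localizedAction_mk_mk T L X a s t x

variable (L X)

lemma isScalarTower_localizedAlgebraModule :
    IsScalarTower (Localization T) (LocalizedModule T L) (LocalizedModule T X) where
  smul_assoc r a x := by
    induction r using Localization.induction_on with | _ r
    induction a using LocalizedModule.induction_on with | _ a s
    induction x using LocalizedModule.induction_on with | _ x t
    simp only [LocalizedModule.mk_smul_mk, LocalizedModule.mk_smul_mk_of_algebra, smul_assoc,
      mul_assoc]

lemma isScalarTower_localizedAlgebraModule' :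
    IsScalarTower R (LocalizedModule T L) (LocalizedModule T X) where
  smul_assoc r a x := by
    induction a using LocalizedModule.induction_on with | _ a s
    induction x using LocalizedModule.induction_on with | _ x t
    simp only [LocalizedModule.smul'_mk, LocalizedModule.mk_smul_mk_of_algebra, smul_assoc]

attribute [local instance] isScalarTower_localizedAlgebraModule
  isScalarTower_localizedAlgebraModule'

lemma finite_localizedAlgebraModule [Module.Finite R L] [Module.Finite L X] :
    Module.Finite (LocalizedModule T L) (LocalizedModule T X) := by
  have : Module.Finite R X := Module.Finite.trans L X
  have : Module.Finite (Localization T) (LocalizedModule T X) :=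
    Module.Finite.of_isLocalizedModule T (LocalizedModule.mkLinearMap T X)
  exact Module.Finite.of_restrictScalars_finite (Localization T) _ _

variable {L X}
variable {Y : Type u} [AddCommGroup Y] [Module R Y] [Module L Y] [IsScalarTower R L Y]

/-- The localization of a linear map over an `R`-algebra. -/
noncomputable def localizedAlgebraMap (f : X →ₗ[L] Y) :
    LocalizedModule T X →ₗ[LocalizedModule T L] LocalizedModule T Y where
  toFun := IsLocalizedModule.map T (LocalizedModule.mkLinearMap T X)
    (LocalizedModule.mkLinearMap T Y) (f.restrictScalars R)
  map_add' := map_add _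
  map_smul' a x := by
    induction a using LocalizedModule.induction_on with | _ a s
    induction x using LocalizedModule.induction_on with | _ x t
    simp only [LocalizedModule.mk_smul_mk_of_algebra, IsLocalizedModule.map_LocalizedModules,
      LinearMap.restrictScalars_apply, map_smul, RingHom.id_apply]

lemma localizedAlgebraMap_mk (f : X →ₗ[L] Y) (x : X) (s : T) :
    localizedAlgebraMap T f (LocalizedModule.mk x s) = LocalizedModule.mk (f x) s :=
  IsLocalizedModule.map_LocalizedModules T (f.restrictScalars R) x s

lemma localizedAlgebraMap_injective (f : X →ₗ[L] Y) (hf : Function.Injective f) :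
    Function.Injective (localizedAlgebraMap T f) :=
  IsLocalizedModule.map_injective T (LocalizedModule.mkLinearMap T X)
    (LocalizedModule.mkLinearMap T Y) (f.restrictScalars R) hf

lemma localizedAlgebraMap_surjective (f : X →ₗ[L] Y) (hf : Function.Surjective f) :
    Function.Surjective (localizedAlgebraMap T f) :=
  IsLocalizedModule.map_surjective T (LocalizedModule.mkLinearMap T X)
    (LocalizedModule.mkLinearMap T Y) (f.restrictScalars R) hf

variable {Z : Type u} [AddCommGroup Z] [Module R Z] [Module L Z] [IsScalarTower R L Z]

lemma localizedAlgebraMap_exact (f : X →ₗ[L] Y) (g : Y →ₗ[L] Z) (h : Function.Exact f g) :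
    Function.Exact (localizedAlgebraMap T f) (localizedAlgebraMap T g) :=
  IsLocalizedModule.map_exact T (LocalizedModule.mkLinearMap T X)
    (LocalizedModule.mkLinearMap T Y) (LocalizedModule.mkLinearMap T Z)
    (f.restrictScalars R) (g.restrictScalars R) h

variable (L) in
lemma projective_localizedAlgebraModule_pi (k : ℕ) :
    Module.Projective (LocalizedModule T L) (LocalizedModule T (Fin k → L)) := by
  let ψ : LocalizedModule T (Fin k → L) →ₗ[LocalizedModule T L] (Fin k → LocalizedModule T L) :=
    { toFun x i := IsLocalizedModule.map T (LocalizedModule.mkLinearMap T (Fin k → L))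
        (LocalizedModule.mkLinearMap T L) (LinearMap.proj i) x
      map_add' x y := by ext i; simp only [map_add, Pi.add_apply]
      map_smul' a x := by
        ext i
        induction a using LocalizedModule.induction_on with | _ a s
        induction x using LocalizedModule.induction_on with | _ x t
        simp only [LocalizedModule.mk_smul_mk_of_algebra, IsLocalizedModule.map_LocalizedModules,
          LinearMap.proj_apply, Pi.smul_apply, smul_eq_mul, RingHom.id_apply,
          LocalizedModule.mk_mul_mk] }
  let φ : (Fin k → LocalizedModule T L) →ₗ[LocalizedModule T L] LocalizedModule T (Fin k → L) :=
    Fintype.linearCombination _ fun i ↦ LocalizedModule.mk (Pi.single i 1) 1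
  refine Module.Projective.of_split ψ φ (LinearMap.ext fun x ↦ ?_)
  induction x using LocalizedModule.induction_on with | _ x t
  have hψ (i : Fin k) : ψ (LocalizedModule.mk x t) i = LocalizedModule.mk (x i) t :=
    IsLocalizedModule.map_LocalizedModules T (LinearMap.proj i) x t
  have hsum : x = ∑ i, x i • (Pi.single i 1 : Fin k → L) := by
    ext j
    simp [Pi.single_apply]
  change φ (ψ _) = _
  simp only [φ, Fintype.linearCombination_apply, hψ, LocalizedModule.mk_smul_mk_of_algebra, mul_one,
    LinearMap.id_apply]
  conv_rhs => rw [hsum]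
  have h (y : Fin k → L) : LocalizedModule.mk y t = LocalizedModule.divBy t
    (LocalizedModule.mkLinearMap T _ y) := by
    simp [LocalizedModule.divBy, LocalizedModule.liftOn_mk]
  simp only [h, map_sum]

lemma exists_linearMap_of_localizedModule [IsNoetherianRing R] [Module.Finite R L]
    [Module.Finite L X]
    (σ : LocalizedModule T X →ₗ[LocalizedModule T L] LocalizedModule T Y) :
    ∃ (s : T) (τ : X →ₗ[L] Y), ∀ x,
      LocalizedModule.mk (τ x) 1 = (s : R) • σ (LocalizedModule.mk x 1) := by
  have : Module.Finite R X := Module.Finite.trans L X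
  have : Module.FinitePresentation R X := Module.finitePresentation_of_finite R X
  obtain ⟨h, s, hs⟩ := Module.FinitePresentation.exists_lift_of_isLocalizedModule T
    (LocalizedModule.mkLinearMap T Y)
    (σ.restrictScalars R ∘ₗ LocalizedModule.mkLinearMap T X)
  replace hs (x : X) : LocalizedModule.mk (h x) 1 = (s : R) • σ (LocalizedModule.mk x 1) :=
    LinearMap.congr_fun hs x
  have hmk {W : Type u} [AddCommGroup W] [Module R W] [Module L W] [IsScalarTower R L W]
      (a : L) (z : W) : (LocalizedModule.mk (a • z) 1 : LocalizedModule T W) =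
      LocalizedModule.mk a (1 : T) • LocalizedModule.mk z 1 := by
    rw [LocalizedModule.mk_smul_mk_of_algebra, mul_one]
  have : SMulCommClass R (LocalizedModule T L) (LocalizedModule T Y) := ⟨fun r a z ↦ by
    induction a using LocalizedModule.induction_on with | _ a s
    induction z using LocalizedModule.induction_on with | _ x t
    simp only [LocalizedModule.smul'_mk, LocalizedModule.mk_smul_mk_of_algebra,
      smul_algebra_smul_comm]⟩
  obtain ⟨t, ht⟩ := Module.Finite.exists_smul_of_comp_eq_of_isLocalizedModule T
    (LocalizedModule.mkLinearMap T Y)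
    (h ∘ₗ TensorProduct.lift (Algebra.lsmul R R X : L →ₐ[R] Module.End R X).toLinearMap)
    (TensorProduct.lift ((LinearMap.lcomp R Y h) ∘ₗ
      (Algebra.lsmul R R Y : L →ₐ[R] Module.End R Y).toLinearMap))
    (TensorProduct.ext' fun a x ↦ by
      change LocalizedModule.mk (h (a • x)) 1 = LocalizedModule.mk (a • h x) 1
      rw [hs, hmk, map_smul, hmk, hs, smul_comm])
  have ht' (a : L) (x : X) : (t : R) • h (a • x) = (t : R) • a • h x :=
    LinearMap.congr_fun ht (a ⊗ₜ[R] x)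
  refine ⟨t * s, { (t : R) • h with map_smul' a x := ?_ }, fun x ↦ ?_⟩
  · change (t : R) • h (a • x) = a • (t : R) • h x
    rw [ht', smul_algebra_smul_comm]
  · change LocalizedModule.mk ((t : R) • h x) 1 = _
    rw [← LocalizedModule.smul'_mk, hs, ← mul_smul, Submonoid.coe_mul]

lemma projective_of_forall_isMaximal [IsNoetherianRing R] [Module.Finite R L] [Module.Finite L X]
    (h : ∀ (m : Ideal R) [m.IsMaximal],
      Module.Projective (LocalizedModule m.primeCompl L) (LocalizedModule m.primeCompl X)) :
    Module.Projective L X := by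
  obtain ⟨k, f, hf⟩ := Module.Finite.exists_fin' L X
  have : Module.Finite R X := Module.Finite.trans L X
  let I : Ideal R :=
    { carrier := {r | ∃ τ : X →ₗ[L] (Fin k → L), ∀ x, f (τ x) = r • x}
      add_mem' := by
        rintro r s ⟨τ, hτ⟩ ⟨τ', hτ'⟩
        exact ⟨τ + τ', fun x ↦ by rw [LinearMap.add_apply, map_add, hτ, hτ', add_smul]⟩
      zero_mem' := ⟨0, fun x ↦ by rw [LinearMap.zero_apply, map_zero, zero_smul]⟩
      smul_mem' := by
        rintro r s ⟨τ, hτ⟩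
        refine ⟨τ ∘ₗ (Module.toModuleEnd L (S := R) X r), fun x ↦ ?_⟩
        rw [LinearMap.comp_apply, hτ, smul_eq_mul, mul_comm, mul_smul]
        rfl }
  have hI : I = ⊤ := by
    by_contra hne
    obtain ⟨m, hm, hIm⟩ := Ideal.exists_le_maximal I hne
    have := h m
    obtain ⟨σ, hσ⟩ := Module.projective_lifting_property
      (localizedAlgebraMap m.primeCompl f) LinearMap.id
      (localizedAlgebraMap_surjective m.primeCompl f hf)
    obtain ⟨s, τ, hτ⟩ := exists_linearMap_of_localizedModule m.primeCompl σ
    obtain ⟨t, ht⟩ := Module.Finite.exists_smul_of_comp_eq_of_isLocalizedModule m.primeCompl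
      (LocalizedModule.mkLinearMap m.primeCompl X)
      ((f ∘ₗ τ).restrictScalars R) ((s : R) • LinearMap.id) (LinearMap.ext fun x ↦ by
        change LocalizedModule.mk (f (τ x)) 1 = LocalizedModule.mk ((s : R) • x) 1
        rw [← localizedAlgebraMap_mk, hτ, ← LocalizedModule.smul'_mk]
        refine ((localizedAlgebraMap m.primeCompl f).map_smul_of_tower (s : R) _).trans ?_
        exact congrArg _ (LinearMap.congr_fun hσ _))
    have hmem : (t * s : R) ∈ I := by
      refine ⟨τ ∘ₗ (Module.toModuleEnd L (S := R) X (t : R)), fun x ↦ ?_⟩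
      rw [LinearMap.comp_apply, mul_smul]
      change f (τ ((t : R) • x)) = _
      rw [τ.map_smul_of_tower, f.map_smul_of_tower]
      exact LinearMap.congr_fun ht x
    exact (t * s).2 (hIm hmem)
  obtain ⟨τ, hτ⟩ : (1 : R) ∈ I := hI ▸ Submodule.mem_top
  exact Module.Projective.of_split τ f (LinearMap.ext fun x ↦ (hτ x).trans (one_smul R x))

lemma hasProjectiveDimensionLT_of_forall_isMaximal [IsNoetherianRing R] [Module.Finite R L]
    (n : ℕ) (X : Type u) [AddCommGroup X] [Module R X] [Module L X] [IsScalarTower R L X]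
    [Module.Finite L X]
    (h : ∀ (m : Ideal R) [m.IsMaximal], HasProjectiveDimensionLT (ModuleCat.of
      (LocalizedModule m.primeCompl L) (LocalizedModule m.primeCompl X)) (n + 1)) :
    HasProjectiveDimensionLT (ModuleCat.of L X) (n + 1) := by
  induction n generalizing X with
  | zero =>
    rw [zero_add, ← projective_iff_hasProjectiveDimensionLT_one, ← IsProjective.iff_projective]
    refine projective_of_forall_isMaximal (R := R) fun m _ ↦ ?_
    rw [IsProjective.iff_projective, projective_iff_hasProjectiveDimensionLT_one]
    exact h m
  | succ n ih =>
    obtain ⟨k, f, hf⟩ := Module.Finite.exists_fin' L X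
    have : IsNoetherianRing L := isNoetherian_of_tower R inferInstance
    have : Projective (ModuleCat.of L (Fin k → L)) :=
      (IsProjective.iff_projective _).1 inferInstance
    refine ((LinearMap.shortExact_shortComplexKer hf).hasProjectiveDimensionLT_X₃_iff n this).2
      (ih (LinearMap.ker f) fun m _ ↦ ?_)
    let T := m.primeCompl
    let S : ShortComplex (ModuleCat (LocalizedModule T L)) :=
      { X₁ := ModuleCat.of _ (LocalizedModule T (LinearMap.ker f))
        X₂ := ModuleCat.of _ (LocalizedModule T (Fin k → L))
        X₃ := ModuleCat.of _ (LocalizedModule T X)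
        f := ModuleCat.ofHom (localizedAlgebraMap T (LinearMap.ker f).subtype)
        g := ModuleCat.ofHom (localizedAlgebraMap T f)
        zero := ModuleCat.hom_ext <| LinearMap.ext fun x ↦
          (localizedAlgebraMap_exact T _ f f.exact_subtype_ker_map).apply_apply_eq_zero x }
    have hS : S.ShortExact :=
      { exact := (ShortComplex.ShortExact.moduleCat_exact_iff_function_exact S).2
          (localizedAlgebraMap_exact T _ f f.exact_subtype_ker_map)
        mono_f := (ModuleCat.mono_iff_injective _).2
          (localizedAlgebraMap_injective T _ (LinearMap.ker f).subtype_injective)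
        epi_g := (ModuleCat.epi_iff_surjective _).2 (localizedAlgebraMap_surjective T f hf) }
    have hP : Projective S.X₂ := by
      have := projective_localizedAlgebraModule_pi T L k
      exact (IsProjective.iff_projective _).1 this
    exact (hS.hasProjectiveDimensionLT_X₃_iff n hP).1 (h m)

/-- Localization commutes with taking the dual of a finitely presented module. -/
noncomputable def localizedDualEquiv (W : Type u) [AddCommGroup W] [Module R W]
    [Module.FinitePresentation R W] {X : Type u} [AddCommGroup X] [Module R X]
    (e : X ≃ₗ[R] Module.Dual R W) :
    LocalizedModule T X ≃ₗ[Localization T] (LocalizedModule T W →ₗ[R] Localization T) :=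
  LinearEquiv.extendScalarsOfIsLocalization T (Localization T) <|
    (IsLocalizedModule.linearEquiv T (LocalizedModule.mkLinearMap T X)
      (LocalizedModule.mkLinearMap T (Module.Dual R W) ∘ₗ e.toLinearMap)).trans <|
    IsLocalizedModule.linearEquiv T (LocalizedModule.mkLinearMap T (Module.Dual R W))
      (IsLocalizedModule.map T (LocalizedModule.mkLinearMap T W)
        (Algebra.linearMap R (Localization T)))

lemma hasProjectiveDimensionLT_of_equiv_dual [IsNoetherianRing R] [Module.Finite R L]
    {W : Type u} [AddCommGroup W] [Module R W] [Module.Finite R W]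
    (X : Type u) [AddCommGroup X] [Module R X] [Module L X] [IsScalarTower R L X]
    (e : X ≃ₗ[R] Module.Dual R W) (n : ℕ)
    (hdim : ∀ (m : Ideal R) [m.IsMaximal],
      globalDim (LocalizedModule m.primeCompl L) ≤ (n + 2 : ℕ))
    (hdepth : ∀ (m : Ideal R) [m.IsMaximal],
      2 ≤ rdepth (Localization.AtPrime m) (Localization.AtPrime m)) :
    HasProjectiveDimensionLT (ModuleCat.of L X) (n + 1) := by
  have : Module.Finite R X := Module.Finite.equiv e.symm
  have : Module.Finite L X := Module.Finite.of_restrictScalars_finite R L X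
  have : Module.FinitePresentation R W := Module.finitePresentation_of_finite R W
  refine hasProjectiveDimensionLT_of_forall_isMaximal (R := R) n X fun m _ ↦ ?_
  obtain ⟨x, hx, y, hy, hxreg, hyreg⟩ := exists_regular_pair_of_two_le_rdepth (hdepth m)
  let E := localizedDualEquiv m.primeCompl W e
  have : Module.Finite (Localization.AtPrime m) (LocalizedModule m.primeCompl L) :=
    Module.Finite.of_isLocalizedModule m.primeCompl (LocalizedModule.mkLinearMap m.primeCompl L)
  have := finite_localizedAlgebraModule m.primeCompl L X
  have : IsNoetherianRing (Localization.AtPrime m) :=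
    IsLocalization.isNoetherianRing m.primeCompl _ inferInstance
  refine hasProjectiveDimensionLT_of_regular_pair (S := Localization.AtPrime m) _ hx hy
    (fun a b hab ↦ E.injective (IsSMulRegular.linearMap _ hxreg ?_)) (fun a b hab ↦ ?_) n
    (hasProjectiveDimensionLT_of_globalDim_le (hdim m))
  · exact (E.map_smul x a).symm.trans ((congrArg E hab).trans (E.map_smul x b))
  · obtain ⟨c, hc⟩ := exists_eq_smul_linearMap_of_regular_pair _ hxreg hyreg (E a) (E b)
      ((E.map_smul y a).symm.trans ((congrArg E hab).trans (E.map_smul x b)))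
    exact ⟨E.symm c, E.injective (by rw [hc, map_smul, E.apply_symm_apply])⟩

end Localization

lemma EquiCodimensional.ringKrullDim_localization_eq {R : Type u} [CommRing R]
    (h : EquiCodimensional R) (m : Ideal R) [hm : m.IsMaximal] :
    ringKrullDim (Localization.AtPrime m) = ringKrullDim R := by
  rw [IsLocalization.AtPrime.ringKrullDim_eq_height m]
  refine le_antisymm Ideal.height_le_ringKrullDim_of_isPrime
    ((ringKrullDim_le_iff_isMaximal_height_le _).2 fun m' hm' ↦ ?_)
  have h1 : m'.height = primeHeight m' hm'.isPrime :=
    PrimeSpectrum.height_eq_orderHeight ⟨m', hm'.isPrime⟩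
  have h2 : m.height = primeHeight m hm.isPrime :=
    PrimeSpectrum.height_eq_orderHeight ⟨m, hm.isPrime⟩
  rw [h1, h2, h m' m hm' hm]

instance endOpModuleHom.isScalarTower {R M N : Type u} [CommRing R] [AddCommGroup M] [Module R M]
    [AddCommGroup N] [Module R N] : IsScalarTower R (Module.End R M)ᵐᵒᵖ (M →ₗ[R] N) where
  smul_assoc r _ g := LinearMap.ext fun _ ↦ map_smul g r _

/-- projective dimension of `Hom_R(M,N)` over an NCCR. -/
theorem stmt12 (R : Type u) [CommRing R] [IsNoetherianRing R] [IsDomain R]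
    [IsIntegrallyClosed R]
    (hCM : IsCMRing R) (hEq : EquiCodimensional R)
    (d : ℕ) (hd2 : 2 ≤ d) (hd : ringKrullDim R = d)
    (w : Type u) [AddCommGroup w] [Module R w] (hw : IsGlobalCanonicalModule R w)
    (M : Type u) [AddCommGroup M] [Module R M] (hM : IsNCCR R M)
    (N : Type u) [AddCommGroup N] [Module R N] [Module.Finite R N]
    (hN : Module.IsReflexive R N) :
    projDim (Module.End R M)ᵐᵒᵖ (M →ₗ[R] N) ≤ ((d - 2 : ℕ) : ℕ∞) := by
  have hM' := hM.2.2.2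
  have := hM.2.1
  have := hM'.finite
  have hdim (m : Ideal R) [m.IsMaximal] : ringKrullDim (Localization.AtPrime m) = (d : ℕ∞) :=
    (hEq.ringKrullDim_localization_eq m).trans hd
  refine projDim_le_of_hasProjectiveDimensionLT _ _ <| hasProjectiveDimensionLT_of_equiv_dual _
    (((Module.evalEquiv R N).congrRight).trans
      (TensorProduct.lift.equiv (RingHom.id R) M (Module.Dual R N) R)) _
    (fun m hm ↦ ?_) (fun m hm ↦ ?_)
  · rw [Nat.sub_add_cancel hd2]
    exact (WithBot.coe_injective ((hM'.gldim m hm.isPrime).trans (hdim m))).le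
  · have h : rdepth (Localization.AtPrime m) (Localization.AtPrime m) = d :=
      WithBot.coe_injective ((hCM m hm.isPrime).trans (hdim m))
    rw [h]
    exact_mod_cast hd2
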